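/- Let f : B^n → C^n be continuous on the closed unit ball, hyperbolic-harmonic in each component on B^n, and satisfy |f(z)| ≤ M for all z ∈ B^n, where M > 0. Then for every z ∈ B^n, Λ_f(z) ≤ 2(2n−1)M/(1−|z|)², where Λ_f(z) = max_{θ ∈ ∂B^n} | f_z(z)θ + f_{z̄}(z)θ̄ |. -/

import Mathlib

open MeasureTheory Metric Complex

noncomputable section

/-- `ℂⁿ` with the Euclidean norm. -/
abbrev Cn (n : ℕ) := EuclideanSpace ℂ (Fin n)

/-- The Wirtinger derivative `∂f/∂z_k = (∂f/∂x_k - i ∂f/∂y_k)/2`. -/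
noncomputable def wdz (n : ℕ) (f : Cn n → ℂ) (z : Cn n) (k : Fin n) : ℂ :=
  (1 / 2 : ℂ) *
    (fderiv ℝ f z (EuclideanSpace.single k 1) -
      Complex.I * fderiv ℝ f z (EuclideanSpace.single k Complex.I))

/-- The Wirtinger derivative `∂f/∂z̄_k = (∂f/∂x_k + i ∂f/∂y_k)/2`. -/
noncomputable def wdzbar (n : ℕ) (f : Cn n → ℂ) (z : Cn n) (k : Fin n) : ℂ :=
  (1 / 2 : ℂ) *
    (fderiv ℝ f z (EuclideanSpace.single k 1) +
      Complex.I * fderiv ℝ f z (EuclideanSpace.single k Complex.I))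

/-- Euclidean norm of a vector of complex numbers. -/
noncomputable def euclNorm (n : ℕ) (v : Fin n → ℂ) : ℝ :=
  Real.sqrt (∑ k, Complex.normSq (v k))

/-- The Laplace–Beltrami operator
`Δ_h u = (1-|z|²)² Σ_k (u_{x_k x_k} + u_{y_k y_k})
  + 4(n-1)(1-|z|²) Σ_k (x_k u_{x_k} + y_k u_{y_k})`. -/
noncomputable def laplaceH (n : ℕ) (u : Cn n → ℝ) (z : Cn n) : ℝ :=
  (1 - ‖z‖ ^ 2) ^ 2 *
      ∑ k, (fderiv ℝ (fun w => fderiv ℝ u w (EuclideanSpace.single k 1)) z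
              (EuclideanSpace.single k 1) +
            fderiv ℝ (fun w => fderiv ℝ u w (EuclideanSpace.single k Complex.I)) z
              (EuclideanSpace.single k Complex.I)) +
    4 * ((n : ℝ) - 1) * (1 - ‖z‖ ^ 2) *
      ∑ k, ((z k).re * fderiv ℝ u z (EuclideanSpace.single k 1) +
            (z k).im * fderiv ℝ u z (EuclideanSpace.single k Complex.I))

/-- A complex-valued function on the unit ball of `ℂⁿ` is hyperbolic-harmonic if it is
twice continuously differentiable there and its real and imaginary parts are annihilated
by the Laplace–Beltrami operator. -/
def IsHHarmonic (n : ℕ) (f : Cn n → ℂ) : Prop :=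
  ContDiffOn ℝ 2 f (ball 0 1) ∧
    ∀ z ∈ ball (0 : Cn n) 1,
      laplaceH n (fun w => (f w).re) z = 0 ∧ laplaceH n (fun w => (f w).im) z = 0
/-- `Λ_f(z) = max_{θ ∈ ∂Bⁿ} |f_z(z)θ + f_{z̄}(z)θ̄|`, where `f_z, f_{z̄}` are the matrices of
Wirtinger derivatives of the components of `f`. -/
noncomputable def LambdaF (n : ℕ) (f : Cn n → Cn n) (z : Cn n) : ℝ :=
  sSup ((fun θ : Cn n =>
      euclNorm n (fun j =>
        ∑ k, (wdz n (fun w => f w j) z k * θ k +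
          wdzbar n (fun w => f w j) z k * (starRingEnd ℂ) (θ k)))) '' sphere (0 : Cn n) 1)

section HypCore
set_option linter.unusedSectionVars false
open Filter Topology Laplacian InnerProductSpace

variable {E : Type*} [NormedAddCommGroup E] [InnerProductSpace ℝ E] [FiniteDimensional ℝ E]

/-- Normalized hyperbolic Laplacian. -/
def LL (u : E → ℝ) (x : E) : ℝ :=
  (1 - ‖x‖ ^ 2) * (Laplacian.laplacian u : E → ℝ) x +
    2 * ((Module.finrank ℝ E : ℝ) - 2) * fderiv ℝ u x x

theorem lapl_eq {F : Type*} [NormedAddCommGroup F] [NormedSpace ℝ F] {ι : Type*} [Fintype ι]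
    (b : OrthonormalBasis ι ℝ E) (u : E → F) (x : E) :
    (Laplacian.laplacian u : E → F) x = ∑ i, fderiv ℝ (fderiv ℝ u) x (b i) (b i) := by
  rw [laplacian_eq_iteratedFDeriv_orthonormalBasis u b]
  simp [iteratedFDeriv_two_apply]

theorem LL_add {u v : E → ℝ} {x : E} (hu : ContDiffAt ℝ 2 u x) (hv : ContDiffAt ℝ 2 v x) :
    LL (fun y => u y + v y) x = LL u x + LL v x := by
  have h1 := hu.laplacian_add hv
  have h2 := fderiv_add (hu.differentiableAt (by norm_num)) (hv.differentiableAt (by norm_num))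
  have e : (fun y => u y + v y) = u + v := rfl
  unfold LL
  rw [e, h1, h2]
  simp only [add_apply]
  ring

theorem LL_smul {u : E → ℝ} {x : E} (c : ℝ) (hu : ContDiffAt ℝ 2 u x) :
    LL (fun y => c * u y) x = c * LL u x := by
  have h1 := laplacian_smul c hu
  have h2 := fderiv_const_smul (hu.differentiableAt (by norm_num)) c
  have e : (fun y => c * u y) = c • u := rfl
  unfold LL
  rw [e, h1, h2]
  simp only [smul_apply, smul_eq_mul]
  ring

theorem LL_const (c : ℝ) (x : E) : LL (fun _ => c) x = 0 := by
  simp [LL]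

theorem LL_sum {ι : Type*} (s : Finset ι) {u : ι → E → ℝ} {x : E}
    (hu : ∀ i ∈ s, ContDiffAt ℝ 2 (u i) x) :
    LL (fun y => ∑ i ∈ s, u i y) x = ∑ i ∈ s, LL (u i) x := by
  classical
  induction s using Finset.induction_on with
  | empty => simp [LL_const]
  | insert a s ha ih =>
    simp only [Finset.sum_insert ha]
    rw [LL_add (hu a (by simp)) (ContDiffAt.sum fun i hi => hu i (by simp [hi])),
      ih fun i hi => hu i (by simp [hi])]

/-- derivative of `fderiv u · e` along a line -/
theorem line_deriv {F : Type*} [NormedAddCommGroup F] [NormedSpace ℝ F]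
    {u : E → F} {x : E} (hu : ContDiffAt ℝ 2 u x) (e : E) :
    HasDerivAt (fun t : ℝ => fderiv ℝ u (x + t • e) e) (fderiv ℝ (fderiv ℝ u) x e e) 0 := by
  have h1 : DifferentiableAt ℝ (fderiv ℝ u) x :=
    (hu.fderiv_right (m := 1) (by norm_num)).differentiableAt (by norm_num)
  have h2 : HasDerivAt (fun t : ℝ => x + t • e) e 0 := by
    simpa using ((hasDerivAt_id (0:ℝ)).smul_const e).const_add x
  have h3 : HasFDerivAt (fderiv ℝ u) (fderiv ℝ (fderiv ℝ u) x) (x + (0:ℝ) • e) := by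
    simpa using h1.hasFDerivAt
  have h4 := h3.comp_hasDerivAt (0:ℝ) h2
  simpa using h4.clm_apply (hasDerivAt_const (0:ℝ) e)

theorem tendsto_line (x e : E) : Tendsto (fun t : ℝ => x + t • e) (𝓝 0) (𝓝 x) := by
  have : Continuous (fun t : ℝ => x + t • e) := by fun_prop
  simpa using this.tendsto 0

theorem second_eq {F : Type*} [NormedAddCommGroup F] [NormedSpace ℝ F]
    {u : E → F} {x e : E} {G : E → F} {d : F} (hu : ContDiffAt ℝ 2 u x)
    (hG : ∀ᶠ w in 𝓝 x, fderiv ℝ u w e = G w)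
    (hd : HasDerivAt (fun t : ℝ => G (x + t • e)) d 0) :
    fderiv ℝ (fderiv ℝ u) x e e = d := by
  refine (line_deriv hu e).unique (hd.congr_of_eventuallyEq ?_)
  exact (tendsto_line x e).eventually hG

theorem second_nonpos {u : E → ℝ} {x : E} (hu : ContDiffAt ℝ 2 u x) (hm : IsLocalMax u x) (e : E) :
    fderiv ℝ (fderiv ℝ u) x e e ≤ 0 := by
  by_contra! hpos
  set g : ℝ → ℝ := fun t => u (x + t • e) with hg
  have hdiff : ∀ᶠ w in 𝓝 x, DifferentiableAt ℝ u w := by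
    filter_upwards [hu.eventually (by simp)] with w hw
    exact hw.differentiableAt (by norm_num)
  have hg' : deriv g =ᶠ[𝓝 0] fun t : ℝ => fderiv ℝ u (x + t • e) e := by
    filter_upwards [(tendsto_line x e).eventually hdiff] with t ht
    have h2 : HasDerivAt (fun t : ℝ => x + t • e) e t := by
      simpa using ((hasDerivAt_id t).smul_const e).const_add x
    exact (ht.hasFDerivAt.comp_hasDerivAt t h2).deriv
  have h2 : deriv (deriv g) 0 = fderiv ℝ (fderiv ℝ u) x e e := by
    rw [hg'.deriv_eq]; exact (line_deriv hu e).deriv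
  have hmax : IsLocalMax g 0 := by
    have := (tendsto_line x e).eventually hm
    simpa [IsLocalMax, IsMaxFilter, hg] using this
  have hc : ContinuousAt g 0 := by
    have : ContinuousAt u (x + (0:ℝ) • e) := by simpa using hu.continuousAt
    exact ContinuousAt.comp (f := fun t : ℝ => x + t • e) this (by fun_prop)
  have hmin := isLocalMin_of_deriv_deriv_pos (h2 ▸ hpos) hmax.deriv_eq_zero hc
  have heq : g =ᶠ[𝓝 0] fun _ => g 0 := by
    filter_upwards [hmax, hmin] with t h3 h4
    exact le_antisymm h3 h4
  have : deriv (deriv g) 0 = 0 := by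
    rw [heq.deriv.deriv_eq]; simp
  linarith

theorem LL_nonpos {u : E → ℝ} {x : E} (hx : ‖x‖ < 1) (hu : ContDiffAt ℝ 2 u x)
    (hm : IsLocalMax u x) : LL u x ≤ 0 := by
  unfold LL
  rw [hm.fderiv_eq_zero, lapl_eq (stdOrthonormalBasis ℝ E)]
  have : ∑ i, fderiv ℝ (fderiv ℝ u) x (stdOrthonormalBasis ℝ E i) (stdOrthonormalBasis ℝ E i) ≤ 0 :=
    Finset.sum_nonpos fun i _ => second_nonpos hu hm _
  have h2 : 0 ≤ 1 - ‖x‖ ^ 2 := by nlinarith [norm_nonneg x]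
  simpa using mul_nonpos_of_nonneg_of_nonpos h2 this

theorem lap_comp {u : E → ℝ} {R : E → E} {x : E} (hu : ContDiffAt ℝ 2 u (R x))
    (hR : ContDiffAt ℝ 2 R x) (l : ℝ) (A : E ≃ₗᵢ[ℝ] E) (hA : ∀ e, fderiv ℝ R x e = l • A e) :
    (Laplacian.laplacian (fun y => u (R y)) : E → ℝ) x =
      l ^ 2 * (Laplacian.laplacian u : E → ℝ) (R x) +
        fderiv ℝ u (R x) ((Laplacian.laplacian R : E → E) x) := by
  have hd1 : ∀ᶠ w in 𝓝 x, DifferentiableAt ℝ R w := by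
    filter_upwards [hR.eventually (by simp)] with w hw
    exact hw.differentiableAt (by norm_num)
  have hd2 : ∀ᶠ w in 𝓝 x, DifferentiableAt ℝ u (R w) := by
    filter_upwards [hR.continuousAt.eventually (hu.eventually (by simp))] with w hw
    exact hw.differentiableAt (by norm_num)
  have hfu : DifferentiableAt ℝ (fderiv ℝ u) (R x) :=
    (hu.fderiv_right (m := 1) (by norm_num)).differentiableAt (by norm_num)
  have key : ∀ e, fderiv ℝ (fderiv ℝ (fun y => u (R y))) x e e =
      l ^ 2 * fderiv ℝ (fderiv ℝ u) (R x) (A e) (A e) +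
        fderiv ℝ u (R x) (fderiv ℝ (fderiv ℝ R) x e e) := by
    intro e
    refine second_eq (G := fun w => fderiv ℝ u (R w) (fderiv ℝ R w e)) (hu.comp x hR) ?_ ?_
    · filter_upwards [hd1, hd2] with w h1 h2
      have := (h2.hasFDerivAt.comp w h1.hasFDerivAt).fderiv
      change fderiv ℝ (u ∘ R) w e = _
      rw [this]; rfl
    · have h2 : HasDerivAt (fun t : ℝ => x + t • e) e 0 := by
        simpa using ((hasDerivAt_id (0:ℝ)).smul_const e).const_add x
      have h3 : HasFDerivAt R (fderiv ℝ R x) (x + (0:ℝ) • e) := by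
        simpa using hd1.self_of_nhds.hasFDerivAt
      have h4 := h3.comp_hasDerivAt (0:ℝ) h2
      have h5 : HasFDerivAt (fderiv ℝ u) (fderiv ℝ (fderiv ℝ u) (R x)) (R (x + (0:ℝ) • e)) := by
        simpa using hfu.hasFDerivAt
      have h6 := h5.comp_hasDerivAt (0:ℝ) h4
      have h7 := h6.clm_apply (line_deriv hR e)
      refine h7.congr_deriv ?_
      have e0 : x + (0:ℝ) • e = x := by simp
      simp only [Function.comp_apply, e0, hA, map_smul, smul_apply, smul_eq_mul]
      ring
  set b := stdOrthonormalBasis ℝ E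
  rw [lapl_eq b, lapl_eq b R, lapl_eq (b.map A) u]
  simp only [key, Finset.sum_add_distrib, map_sum, Finset.mul_sum, OrthonormalBasis.map_apply]

theorem LL_comp {u : E → ℝ} {R : E → E} {x : E} (hu : ContDiffAt ℝ 2 u (R x))
    (hR : ContDiffAt ℝ 2 R x) (l : ℝ) (A : E ≃ₗᵢ[ℝ] E) (hA : ∀ e, fderiv ℝ R x e = l • A e)
    (hN : 1 - ‖R x‖ ^ 2 = l * (1 - ‖x‖ ^ 2))
    (hT : (1 - ‖x‖ ^ 2) • (Laplacian.laplacian R : E → E) x +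
      (2 * ((Module.finrank ℝ E : ℝ) - 2)) • fderiv ℝ R x x =
      (l * (2 * ((Module.finrank ℝ E : ℝ) - 2))) • R x) :
    LL (fun y => u (R y)) x = l * LL u (R x) := by
  have h1 : fderiv ℝ (fun y => u (R y)) x x = fderiv ℝ u (R x) (fderiv ℝ R x x) := by
    change fderiv ℝ (u ∘ R) x x = _
    rw [fderiv_comp x (hu.differentiableAt (by norm_num)) (hR.differentiableAt (by norm_num))]
    rfl
  have h2 := congrArg (fderiv ℝ u (R x)) hT
  simp only [map_add, map_smul, smul_eq_mul] at h2
  unfold LL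
  rw [lap_comp hu hR l A hA, h1, hN]
  linear_combination h2


theorem hasDeriv_normsq (x e : E) :
    HasDerivAt (fun t : ℝ => ‖x + t • e‖ ^ 2) (2 * inner ℝ x e) 0 := by
  have h2 : HasDerivAt (fun t : ℝ => x + t • e) e 0 := by
    simpa using ((hasDerivAt_id (0:ℝ)).smul_const e).const_add x
  simpa using h2.norm_sq

theorem hasDeriv_inner (x e : E) :
    HasDerivAt (fun t : ℝ => (inner ℝ (x + t • e) e : ℝ)) (‖e‖ ^ 2) 0 := by
  have h2 : HasDerivAt (fun t : ℝ => x + t • e) e 0 := by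
    simpa using ((hasDerivAt_id (0:ℝ)).smul_const e).const_add x
  simpa using h2.inner ℝ (hasDerivAt_const (0:ℝ) e)

theorem inv_fderiv (c : E) (ρ : ℝ) {w : E} (hw : w ≠ c) (e : E) :
    fderiv ℝ (EuclideanGeometry.inversion c ρ) w e =
      (ρ ^ 2 * (‖w - c‖ ^ 2)⁻¹) • (e - (2 * (inner ℝ (w - c) e * (‖w - c‖ ^ 2)⁻¹)) • (w - c)) := by
  rw [(EuclideanGeometry.hasFDerivAt_inversion hw).fderiv]
  have : ((ℝ ∙ (w - c))ᗮ.reflection : E → E) e =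
      e - (2 * (inner ℝ (w - c) e * (‖w - c‖ ^ 2)⁻¹)) • (w - c) := by
    rw [Submodule.reflection_orthogonal_apply, Submodule.reflection_singleton_apply]
    simp only [RCLike.ofReal_real_eq_id, id, div_eq_mul_inv]
    module
  rw [← this, dist_eq_norm, div_pow, div_eq_mul_inv]
  rfl

theorem inv_lap (c : E) (ρ : ℝ) {x : E} (hx : x ≠ c) :
    (Laplacian.laplacian (EuclideanGeometry.inversion c ρ) : E → E) x =
      (ρ ^ 2 * ((‖x - c‖ ^ 2)⁻¹) ^ 2 * (4 - 2 * (Module.finrank ℝ E : ℝ))) • (x - c) := by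
  have hR : ContDiffAt ℝ 2 (EuclideanGeometry.inversion c ρ) x :=
    contDiffAt_const.inversion contDiffAt_const contDiffAt_id hx
  have hD : ‖x - c‖ ^ 2 ≠ 0 := by simpa [sub_eq_zero] using hx
  set y := x - c with hy
  set D := ‖y‖ ^ 2 with hDdef
  have key : ∀ e, fderiv ℝ (fderiv ℝ (EuclideanGeometry.inversion c ρ)) x e e =
      (ρ ^ 2 * (D⁻¹) ^ 2) • ((-4 * inner ℝ y e : ℝ) • e + (8 * D⁻¹ * (inner ℝ y e) ^ 2 : ℝ) • y
        - (2 * ‖e‖ ^ 2) • y) := by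
    intro e
    refine second_eq (G := fun w => (ρ ^ 2 * (‖w - c‖ ^ 2)⁻¹) •
      (e - (2 * (inner ℝ (w - c) e * (‖w - c‖ ^ 2)⁻¹)) • (w - c))) hR ?_ ?_
    · filter_upwards [isOpen_ne.mem_nhds hx] with w hw
      exact inv_fderiv c ρ hw e
    · have e1 : ∀ t : ℝ, x + t • e - c = y + t • e := fun t => by rw [hy]; abel
      simp only [e1]
      have h1 : HasDerivAt (fun t : ℝ => (‖y + t • e‖ ^ 2)⁻¹) _ 0 :=
        (hasDeriv_normsq y e).fun_inv (by simpa [hDdef] using hD)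
      have h2 : HasDerivAt (fun t : ℝ => y + t • e) e 0 := by
        simpa using ((hasDerivAt_id (0:ℝ)).smul_const e).const_add y
      have h3 := (((hasDeriv_inner y e).fun_mul h1).const_mul 2).fun_smul h2
      have h4 := (h1.const_mul (ρ ^ 2)).fun_smul ((hasDerivAt_const (0:ℝ) e).fun_sub h3)
      refine h4.congr_deriv ?_
      simp only [zero_smul, add_zero, ← hDdef]
      clear_value D y
      match_scalars
      · field_simp
        ring
      · field_simp
        ring
  set b := stdOrthonormalBasis ℝ E
  rw [lapl_eq b]
  simp only [key]
  rw [← Finset.smul_sum, Finset.sum_sub_distrib, Finset.sum_add_distrib]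
  have s1 : ∑ i, (-4 * inner ℝ y (b i) : ℝ) • b i = (-4 : ℝ) • y := by
    simp only [mul_smul]
    rw [← Finset.smul_sum]
    congr 1
    simpa [real_inner_comm] using b.sum_repr' y
  have s2 : ∑ i, (8 * D⁻¹ * (inner ℝ y (b i)) ^ 2 : ℝ) • y = (8 : ℝ) • y := by
    rw [← Finset.sum_smul, ← Finset.mul_sum]
    have := b.sum_sq_inner_left y
    rw [this, ← hDdef]
    congr 1
    field_simp
  have s3 : ∑ i, (2 * ‖b i‖ ^ 2 : ℝ) • y = (2 * (Module.finrank ℝ E : ℝ)) • y := by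
    rw [← Finset.sum_smul]
    congr 1
    simp [mul_comm]
  rw [s1, s2, s3]
  module

/-- bounded h-harmonic function, continuous up to the boundary -/
structure Nice (u : E → ℝ) (M : ℝ) : Prop where
  cont : ContinuousOn u (closedBall 0 1)
  smooth : ∀ x ∈ ball (0 : E) 1, ContDiffAt ℝ 2 u x
  harm : ∀ x ∈ ball (0 : E) 1, LL u x = 0
  bd : ∀ x ∈ closedBall (0 : E) 1, |u x| ≤ M

theorem Nice.inversion {u : E → ℝ} {M : ℝ} (h : Nice u M) (c : E) (ρ : ℝ) (hρ : ρ ≠ 0)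
    (hc : ‖c‖ ^ 2 = 1 + ρ ^ 2) : Nice (fun x => u (EuclideanGeometry.inversion c ρ x)) M := by
  have hρ2 : 0 < ρ ^ 2 := by positivity
  have hc1 : 1 < ‖c‖ := by nlinarith [norm_nonneg c]
  have hne : ∀ x ∈ closedBall (0 : E) 1, x ≠ c := by
    rintro x hx rfl
    simp at hx
    linarith
  have hN : ∀ x ∈ closedBall (0 : E) 1, 1 - ‖EuclideanGeometry.inversion c ρ x‖ ^ 2 =
      (ρ ^ 2 * (‖x - c‖ ^ 2)⁻¹) * (1 - ‖x‖ ^ 2) := by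
    intro x hx
    have hD : ‖x - c‖ ^ 2 ≠ 0 := by simpa [sub_eq_zero] using hne x hx
    have e1 : EuclideanGeometry.inversion c ρ x = (ρ ^ 2 * (‖x - c‖ ^ 2)⁻¹) • (x - c) + c := by
      simp [EuclideanGeometry.inversion, dist_eq_norm, mul_pow, div_eq_mul_inv]
    have e2 : ‖x‖ ^ 2 = ‖x - c‖ ^ 2 + 2 * inner ℝ (x - c) c + ‖c‖ ^ 2 := by
      rw [← norm_add_sq_real]; simp
    rw [e1, norm_add_sq_real, e2, norm_smul, inner_smul_left, mul_pow, Real.norm_eq_abs, sq_abs, hc]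
    simp only [conj_trivial]
    have hD' : ‖x - c‖ ≠ 0 := fun h => hD (by rw [h]; norm_num)
    field_simp
    ring
  have hl : ∀ x ∈ closedBall (0 : E) 1, 0 < ρ ^ 2 * (‖x - c‖ ^ 2)⁻¹ := by
    intro x hx
    have : 0 < ‖x - c‖ := by simpa [sub_eq_zero] using hne x hx
    positivity
  have hmap : ∀ x ∈ closedBall (0 : E) 1, EuclideanGeometry.inversion c ρ x ∈ closedBall (0 : E) 1 := by
    intro x hx
    have h1 := hN x hx
    have h2 := hl x hx
    have h3 : ‖x‖ ≤ 1 := by simpa using hx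
    have h4 : 0 ≤ 1 - ‖x‖ ^ 2 := by nlinarith [norm_nonneg x]
    have h5 := mul_nonneg h2.le h4
    simp only [mem_closedBall, dist_zero_right]
    nlinarith [norm_nonneg (EuclideanGeometry.inversion c ρ x)]
  have hmap' : ∀ x ∈ ball (0 : E) 1, EuclideanGeometry.inversion c ρ x ∈ ball (0 : E) 1 := by
    intro x hx
    have h1 := hN x (ball_subset_closedBall hx)
    have h2 := hl x (ball_subset_closedBall hx)
    have h3 : ‖x‖ < 1 := by simpa using hx
    have h4 : 0 < 1 - ‖x‖ ^ 2 := by nlinarith [norm_nonneg x]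
    have h5 := mul_pos h2 h4
    simp only [mem_ball, dist_zero_right]
    nlinarith [norm_nonneg (EuclideanGeometry.inversion c ρ x)]
  have hR : ∀ x ∈ closedBall (0 : E) 1, ContDiffAt ℝ 2 (EuclideanGeometry.inversion c ρ) x :=
    fun x hx => contDiffAt_const.inversion contDiffAt_const contDiffAt_id (hne x hx)
  refine ⟨?_, ?_, ?_, ?_⟩
  · exact h.cont.comp (fun x hx => (hR x hx).continuousAt.continuousWithinAt) hmap
  · intro x hx
    exact (h.smooth _ (hmap' x hx)).comp x (hR x (ball_subset_closedBall hx))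
  · intro x hx
    have hx' := ball_subset_closedBall hx
    have hD : ‖x - c‖ ^ 2 ≠ 0 := by simpa [sub_eq_zero] using hne x hx'
    rw [LL_comp (h.smooth _ (hmap' x hx)) (hR x hx') (ρ ^ 2 * (‖x - c‖ ^ 2)⁻¹)
      ((ℝ ∙ (x - c))ᗮ.reflection) ?_ (hN x hx') ?_, h.harm _ (hmap' x hx), mul_zero]
    · intro e
      rw [(EuclideanGeometry.hasFDerivAt_inversion (hne x hx')).fderiv, dist_eq_norm, div_pow,
        div_eq_mul_inv]
      rfl
    · rw [inv_lap c ρ (hne x hx'), inv_fderiv c ρ (hne x hx')]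
      have e1 : EuclideanGeometry.inversion c ρ x = (ρ ^ 2 * (‖x - c‖ ^ 2)⁻¹) • (x - c) + c := by
        simp [EuclideanGeometry.inversion, dist_eq_norm, mul_pow, div_eq_mul_inv]
      rw [e1]
      obtain ⟨y, rfl⟩ : ∃ y, x = y + c := ⟨x - c, by simp⟩
      simp only [add_sub_cancel_right] at hD ⊢
      rw [norm_add_sq_real, inner_add_right, real_inner_self_eq_norm_sq, hc]
      have hD' : ‖y‖ ≠ 0 := fun h => hD (by rw [h]; norm_num)
      match_scalars
      · field_simp
        ring
      · field_simp
  · intro x hx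
    exact h.bd _ (hmap x hx)

theorem Nice.isom {u : E → ℝ} {M : ℝ} (h : Nice u M) (S : E ≃ₗᵢ[ℝ] E) :
    Nice (fun x => u (S x)) M := by
  have hS : ContDiff ℝ 2 (S : E → E) := S.contDiff
  have hf : ∀ x, fderiv ℝ (S : E → E) x = ((S : E ≃L[ℝ] E) : E →L[ℝ] E) := fun x =>
    (S : E ≃L[ℝ] E).fderiv
  refine ⟨?_, ?_, ?_, ?_⟩
  · exact h.cont.comp S.continuous.continuousOn (fun x hx => by simpa using hx)
  · intro x hx
    exact (h.smooth (S x) (by simpa using hx)).comp x hS.contDiffAt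
  · intro x hx
    rw [LL_comp (R := S) (h.smooth _ (by simpa using hx)) hS.contDiffAt 1 S ?_ (by simp) ?_, h.harm _ (by simpa using hx),
      mul_zero]
    · intro e
      rw [hf]; simp
    · have : fderiv ℝ (S : E → E) = fun _ => ((S : E ≃L[ℝ] E) : E →L[ℝ] E) := funext hf
      rw [lapl_eq (stdOrthonormalBasis ℝ E), this]
      simp
  · intro x hx
    exact h.bd _ (by simpa using hx)

theorem Nice.odd {u v : E → ℝ} {M : ℝ} (h : Nice u M) (h' : Nice v M) :
    Nice (fun x => (1 / 2) * u x + (-1 / 2) * v x) M := by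
  refine ⟨?_, ?_, ?_, ?_⟩
  · exact (continuousOn_const.mul h.cont).add (continuousOn_const.mul h'.cont)
  · intro x hx
    exact (contDiffAt_const.mul (h.smooth x hx)).add (contDiffAt_const.mul (h'.smooth x hx))
  · intro x hx
    rw [LL_add (contDiffAt_const.mul (h.smooth x hx)) (contDiffAt_const.mul (h'.smooth x hx)),
      LL_smul _ (h.smooth x hx), LL_smul _ (h'.smooth x hx), h.harm x hx, h'.harm x hx]
    simp
  · intro x hx
    have h1 := abs_le.1 (h.bd x hx)
    have h2 := abs_le.1 (h'.bd x hx)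
    exact abs_le.2 ⟨by linarith, by linarith⟩

/-- Poisson-type kernel. -/
def PK (ζ x : E) : ℝ := (1 - ‖x‖ ^ 2) * (‖x - ζ‖ ^ 2)⁻¹

theorem PK_pos {ζ x : E} (hζ : ‖ζ‖ = 1) (hx : ‖x‖ < 1) : 0 < ‖x - ζ‖ ^ 2 ∧ 0 < PK ζ x := by
  have h1 : 0 < ‖x - ζ‖ := by
    rw [norm_pos_iff, sub_ne_zero]
    rintro rfl
    linarith
  have h2 : 0 < 1 - ‖x‖ ^ 2 := by nlinarith [norm_nonneg x]
  exact ⟨by positivity, by unfold PK; positivity⟩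

theorem PK_smooth {ζ x : E} (hζ : ‖ζ‖ = 1) (hx : ‖x‖ < 1) (α : ℝ) :
    ContDiffAt ℝ 2 (fun y => PK ζ y ^ α) x := by
  obtain ⟨h1, h2⟩ := PK_pos hζ hx
  refine ContDiffAt.rpow_const_of_ne ?_ h2.ne'
  unfold PK
  refine ContDiffAt.mul ?_ (ContDiffAt.inv ?_ h1.ne')
  · exact contDiffAt_const.sub (contDiffAt_id.norm_sq ℝ)
  · exact (contDiffAt_id.sub contDiffAt_const).norm_sq ℝ

theorem PK_line {ζ x : E} (hζ : ‖ζ‖ = 1) (hx : ‖x‖ < 1) (e : E) :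
    HasDerivAt (fun t : ℝ => PK ζ (x + t • e))
      (-2 * inner ℝ x e * (‖x - ζ‖ ^ 2)⁻¹ -
        2 * (1 - ‖x‖ ^ 2) * inner ℝ (x - ζ) e * ((‖x - ζ‖ ^ 2)⁻¹) ^ 2) 0 := by
  obtain ⟨h1, h2⟩ := PK_pos hζ hx
  unfold PK
  have e1 : ∀ t : ℝ, x + t • e - ζ = (x - ζ) + t • e := fun t => by abel
  simp only [e1]
  have h3 : HasDerivAt (fun t : ℝ => (‖(x - ζ) + t • e‖ ^ 2)⁻¹) _ 0 :=
    (hasDeriv_normsq (x - ζ) e).fun_inv (by simpa using h1.ne')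
  have h4 := ((hasDeriv_normsq x e).const_sub 1).fun_mul h3
  refine h4.congr_deriv ?_
  simp only [zero_smul, add_zero]
  ring

theorem PK_fderiv {ζ x : E} (hζ : ‖ζ‖ = 1) (hx : ‖x‖ < 1) (α : ℝ) (e : E) :
    fderiv ℝ (fun y => PK ζ y ^ α) x e = α * PK ζ x ^ (α - 1) *
      (-2 * inner ℝ x e * (‖x - ζ‖ ^ 2)⁻¹ -
        2 * (1 - ‖x‖ ^ 2) * inner ℝ (x - ζ) e * ((‖x - ζ‖ ^ 2)⁻¹) ^ 2) := by
  obtain ⟨h1, h2⟩ := PK_pos hζ hx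
  have h3 := (PK_line hζ hx e).rpow_const (p := α) (Or.inl (by simpa using h2.ne'))
  have h5 : HasDerivAt (fun t : ℝ => x + t • e) e 0 := by
    simpa using ((hasDerivAt_id (0:ℝ)).smul_const e).const_add x
  have h4 : HasFDerivAt (fun y => PK ζ y ^ α) (fderiv ℝ (fun y => PK ζ y ^ α) x) (x + (0:ℝ) • e) := by
    simpa using ((PK_smooth hζ hx α).differentiableAt (by norm_num)).hasFDerivAt
  have h7 := h4.comp_hasDerivAt (0:ℝ) h5
  have h6 := HasDerivAt.unique h7 h3
  rw [h6]
  simp only [zero_smul, add_zero]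
  ring

theorem PK_LL {ζ x : E} (hζ : ‖ζ‖ = 1) (hx : ‖x‖ < 1) (α : ℝ) :
    LL (fun y => PK ζ y ^ α) x =
      4 * α * (α - ((Module.finrank ℝ E : ℝ) - 1)) * PK ζ x ^ (α - 1) * (‖x - ζ‖ ^ 2)⁻¹ := by
  obtain ⟨h1, h2⟩ := PK_pos hζ hx
  have hN : 0 < 1 - ‖x‖ ^ 2 := by nlinarith [norm_nonneg x]
  have key : ∀ e, fderiv ℝ (fderiv ℝ (fun y => PK ζ y ^ α)) x e e =
      α * PK ζ x ^ (α - 1) * ((α - 1) * (PK ζ x)⁻¹ *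
      (-2 * inner ℝ x e * (‖x - ζ‖ ^ 2)⁻¹ -
        2 * (1 - ‖x‖ ^ 2) * inner ℝ (x - ζ) e * ((‖x - ζ‖ ^ 2)⁻¹) ^ 2) ^ 2 +
      (-2 * ‖e‖ ^ 2 * (‖x - ζ‖ ^ 2)⁻¹ + 8 * (inner ℝ x e * inner ℝ (x - ζ) e) * ((‖x - ζ‖ ^ 2)⁻¹) ^ 2
        - 2 * (1 - ‖x‖ ^ 2) * ‖e‖ ^ 2 * ((‖x - ζ‖ ^ 2)⁻¹) ^ 2
        + 8 * (1 - ‖x‖ ^ 2) * inner ℝ (x - ζ) e ^ 2 * ((‖x - ζ‖ ^ 2)⁻¹) ^ 3)) := by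
    intro e
    refine second_eq (PK_smooth hζ hx α) (G := fun x => α * PK ζ x ^ (α - 1) *
      (-2 * inner ℝ x e * (‖x - ζ‖ ^ 2)⁻¹ -
        2 * (1 - ‖x‖ ^ 2) * inner ℝ (x - ζ) e * ((‖x - ζ‖ ^ 2)⁻¹) ^ 2)) ?_ ?_
    · have : ball (0 : E) 1 ∈ 𝓝 x := isOpen_ball.mem_nhds (by simpa using hx)
      filter_upwards [this] with w hw
      exact PK_fderiv hζ (by simpa using hw) α e
    · have e1 : ∀ t : ℝ, x + t • e - ζ = (x - ζ) + t • e := fun t => by abel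
      have g0 := ((PK_line hζ hx e).rpow_const (p := α - 1)
        (Or.inl (by simpa using h2.ne'))).const_mul α
      simp only [e1]
      have g1 : HasDerivAt (fun t : ℝ => (‖(x - ζ) + t • e‖ ^ 2)⁻¹) _ 0 :=
        (hasDeriv_normsq (x - ζ) e).fun_inv (by simpa using h1.ne')
      have g2 := ((hasDeriv_inner x e).const_mul (-2)).fun_mul g1
      have g3 := ((((hasDeriv_normsq x e).const_sub 1).const_mul 2).fun_mul
        (hasDeriv_inner (x - ζ) e)).fun_mul (g1.fun_pow 2)
      have g4 := g0.fun_mul (g2.fun_sub g3)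
      refine g4.congr_deriv ?_
      simp only [zero_smul, add_zero]
      have e2 : PK ζ x ^ (α - 1 - 1) = PK ζ x ^ (α - 1) * (PK ζ x)⁻¹ := by
        rw [Real.rpow_sub_one h2.ne', div_eq_mul_inv]
      rw [e2]
      simp only [show (2:ℕ) - 1 = 1 from rfl, pow_one, Nat.cast_ofNat]
      set D := ‖x - ζ‖ ^ 2
      field_simp
      ring
  set b := stdOrthonormalBasis ℝ E
  have sx : ∑ i, (inner ℝ x (b i) : ℝ) ^ 2 = ‖x‖ ^ 2 := b.sum_sq_inner_left x
  have sy : ∑ i, (inner ℝ (x - ζ) (b i) : ℝ) ^ 2 = ‖x - ζ‖ ^ 2 := b.sum_sq_inner_left _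
  have sxy : ∑ i, (inner ℝ x (b i) : ℝ) * inner ℝ (x - ζ) (b i) = inner ℝ x (x - ζ) := by
    rw [← b.sum_inner_mul_inner x (x - ζ)]
    exact Finset.sum_congr rfl fun i _ => by rw [real_inner_comm (x - ζ) (b i)]
  have sm : ∑ i, ‖b i‖ ^ 2 = (Module.finrank ℝ E : ℝ) := by simp
  have hin : inner ℝ x (x - ζ) = (‖x - ζ‖ ^ 2 - (1 - ‖x‖ ^ 2)) / 2 := by
    have := norm_sub_sq_real x (x - ζ)
    rw [sub_sub_cancel, hζ] at this
    linarith
  have hL : (Laplacian.laplacian (fun y => PK ζ y ^ α) : E → ℝ) x =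
      α * PK ζ x ^ (α - 1) * ((α - 1) * (PK ζ x)⁻¹ *
      (4 * ((‖x - ζ‖ ^ 2)⁻¹) ^ 2 * ‖x‖ ^ 2 +
        8 * (1 - ‖x‖ ^ 2) * ((‖x - ζ‖ ^ 2)⁻¹) ^ 3 * inner ℝ x (x - ζ) +
        4 * (1 - ‖x‖ ^ 2) ^ 2 * ((‖x - ζ‖ ^ 2)⁻¹) ^ 4 * ‖x - ζ‖ ^ 2) +
      (-2 * (‖x - ζ‖ ^ 2)⁻¹ * (Module.finrank ℝ E : ℝ) +
        8 * ((‖x - ζ‖ ^ 2)⁻¹) ^ 2 * inner ℝ x (x - ζ)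
        - 2 * (1 - ‖x‖ ^ 2) * ((‖x - ζ‖ ^ 2)⁻¹) ^ 2 * (Module.finrank ℝ E : ℝ)
        + 8 * (1 - ‖x‖ ^ 2) * ((‖x - ζ‖ ^ 2)⁻¹) ^ 3 * ‖x - ζ‖ ^ 2)) := by
    conv_rhs => rw [← sxy, ← sm]
    rw [lapl_eq b]
    conv_rhs =>
      enter [2, 1, 2, 1, 1, 2]
      rw [← sx]
    conv_rhs =>
      enter [2, 1, 2, 2, 2]
      rw [← sy]
    conv_rhs =>
      enter [2, 2, 2, 2]
      rw [← sy]
    simp only [key, Finset.mul_sum, ← Finset.sum_add_distrib, ← Finset.sum_sub_distrib]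
    refine Finset.sum_congr rfl fun i _ => ?_
    ring
  unfold LL
  rw [hL, PK_fderiv hζ hx, real_inner_self_eq_norm_sq, real_inner_comm x (x - ζ), hin]
  have e3 : (PK ζ x)⁻¹ = ‖x - ζ‖ ^ 2 / (1 - ‖x‖ ^ 2) := by
    unfold PK; rw [mul_inv, inv_inv]; field_simp
  rw [e3]
  generalize PK ζ x ^ (α - 1) = Q
  obtain ⟨N, hNe⟩ : ∃ N, N = 1 - ‖x‖ ^ 2 := ⟨_, rfl⟩
  have hx2 : ‖x‖ ^ 2 = 1 - N := by linarith
  rw [← hNe] at hN ⊢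
  rw [hx2]
  generalize ‖x - ζ‖ ^ 2 = D at h1 ⊢
  have hN0 := hN.ne'
  have hD0 := h1.ne'
  field_simp
  ring

theorem core_zero {u : E → ℝ} {M : ℝ} (hM : 0 < M) (h : Nice u M) (θ : E) (hθ : ‖θ‖ = 1) :
    fderiv ℝ u 0 θ ≤ 2 * ((Module.finrank ℝ E : ℝ) - 1) * M := by
  have hnt : Nontrivial E := ⟨θ, 0, by rintro rfl; simp at hθ⟩
  have hm : (1 : ℝ) ≤ Module.finrank ℝ E := by exact_mod_cast Module.finrank_pos (R := ℝ) (M := E)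
  suffices H : ∀ α : ℝ, (Module.finrank ℝ E : ℝ) - 1 < α → fderiv ℝ u 0 θ ≤ 2 * α * M by
    refine le_of_forall_pos_le_add fun ε hε => ?_
    have := H ((Module.finrank ℝ E : ℝ) - 1 + ε / (2 * M)) (by
      have : 0 < ε / (2 * M) := by positivity
      linarith)
    refine this.trans (le_of_eq ?_)
    field_simp
  intro α hα
  have hα0 : 0 < α := by linarith
  set S : E ≃ₗᵢ[ℝ] E := (ℝ ∙ θ)ᗮ.reflection with hS
  set w : E → ℝ := fun x => (1 / 2) * u x + (-1 / 2) * u (S x) with hw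
  have hwN : Nice w M := h.odd (h.isom S)
  have hζ : ‖-θ‖ = 1 := by simpa using hθ
  set p : E → ℝ := fun x => PK (-θ) x ^ α with hp
  set g : E → ℝ := fun x => w x + (M * p x + (-M)) with hg
  set K : Set E := closedBall 0 1 ∩ {x | 0 ≤ inner ℝ θ x} with hK
  have hKc : IsCompact K :=
    (isCompact_closedBall 0 1).inter_right (isClosed_le continuous_const (by fun_prop))
  have hDK : ∀ x ∈ K, ‖x - -θ‖ ^ 2 = ‖x‖ ^ 2 + 2 * inner ℝ θ x + 1 := by
    intro x hx
    rw [sub_neg_eq_add, norm_add_sq_real, hθ, real_inner_comm]; ring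
  have hPK : ∀ x ∈ K, 0 ≤ p x ∧ p x ≤ 1 := by
    intro x hx
    have hx1 : ‖x‖ ≤ 1 := by simpa using hx.1
    have hx2 : (0:ℝ) ≤ inner ℝ θ x := hx.2
    have h1 : 0 ≤ 1 - ‖x‖ ^ 2 := by nlinarith [norm_nonneg x]
    have h0 : 0 ≤ PK (-θ) x := mul_nonneg h1 (by positivity)
    refine ⟨Real.rpow_nonneg h0 _, Real.rpow_le_one h0 ?_ hα0.le⟩
    unfold PK
    rw [hDK x hx, ← div_eq_mul_inv, div_le_one (by positivity)]
    nlinarith [sq_nonneg ‖x‖]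
  have hgK : ContinuousOn g K := by
    refine (hwN.cont.mono Set.inter_subset_left).add ((continuousOn_const.mul ?_).add continuousOn_const)
    refine ContinuousOn.rpow_const ?_ fun x hx => Or.inr hα0.le
    unfold PK
    refine ContinuousOn.mul (by fun_prop) (ContinuousOn.inv₀ (by fun_prop) ?_)
    intro x hx
    rw [hDK x hx]
    have hx2 : (0:ℝ) ≤ inner ℝ θ x := hx.2
    positivity
  have h0K : (0 : E) ∈ K := by simp [hK]
  have hgs : ∀ x : E, ‖x‖ < 1 → ContDiffAt ℝ 2 g x := fun x hx =>
    (hwN.smooth x (by simpa using hx)).add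
      ((contDiffAt_const.mul (PK_smooth hζ hx α)).add contDiffAt_const)
  have hmain : ∀ x ∈ K, g x ≤ 0 := by
    obtain ⟨x0, hx0, hmax⟩ := hKc.exists_isMaxOn ⟨0, h0K⟩ hgK
    refine fun x hx => (hmax hx).trans ?_
    have hx1 : ‖x0‖ ≤ 1 := by simpa using hx0.1
    have hx2 : (0:ℝ) ≤ inner ℝ θ x0 := hx0.2
    rcases hx1.eq_or_lt with h1 | h1
    · have hp0 : p x0 = 0 := by
        simp only [hp, PK, h1]
        norm_num [Real.zero_rpow hα0.ne']
      have := (abs_le.1 (hwN.bd x0 hx0.1)).2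
      simp only [hg, hp0]
      linarith
    rcases hx2.eq_or_lt with h2 | h2
    · have hSx : S x0 = x0 := by
        rw [hS]
        exact Submodule.reflection_mem_subspace_eq_self
          (Submodule.mem_orthogonal_singleton_iff_inner_right.2 h2.symm)
      have hw0 : w x0 = 0 := by simp only [hw, hSx]; ring
      simp only [hg, hw0]
      nlinarith [(hPK x0 hx0).2]
    exfalso
    have hnb : K ∈ 𝓝 x0 := by
      refine inter_mem (closedBall_mem_nhds_of_mem (by simpa using h1)) ?_
      have : ∀ᶠ y in 𝓝 x0, (0:ℝ) < inner ℝ θ y :=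
        (show Continuous fun y : E => (inner ℝ θ y : ℝ) by fun_prop).continuousAt.eventually
          (lt_mem_nhds h2)
      filter_upwards [this] with y hy using hy.le
    have hlm : IsLocalMax g x0 := hmax.isLocalMax hnb
    have := LL_nonpos h1 (hgs x0 h1) hlm
    have hps := PK_smooth hζ h1 α
    rw [hg, LL_add (hwN.smooth x0 (by simpa using h1))
      ((contDiffAt_const.mul hps).add contDiffAt_const),
      LL_add (contDiffAt_const.mul hps) contDiffAt_const, LL_smul M hps, LL_const, PK_LL hζ h1,
      hwN.harm x0 (by simpa using h1)] at this
    obtain ⟨q1, q2⟩ := PK_pos hζ h1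
    have q3 : 0 < PK (-θ) x0 ^ (α - 1) := Real.rpow_pos_of_pos q2 _
    have q4 : 0 < α - ((Module.finrank ℝ E : ℝ) - 1) := by linarith
    have : 0 < M * (4 * α * (α - ((Module.finrank ℝ E : ℝ) - 1)) * PK (-θ) x0 ^ (α - 1) *
      (‖x0 - -θ‖ ^ 2)⁻¹) := by positivity
    linarith
  have hg0 : g 0 = 0 := by
    simp [hg, hw, hp, PK, hθ]
    ring
  have hmax0 : IsMaxOn g K 0 := fun x hx => by simpa [hg0] using hmain x hx
  have hd : DifferentiableAt ℝ g 0 := (hgs 0 (by simp)).differentiableAt (by norm_num)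
  have hneg : fderiv ℝ g 0 θ ≤ 0 := by
    refine hmax0.localize.hasFDerivWithinAt_nonpos hd.hasFDerivAt.hasFDerivWithinAt
      (mem_posTangentConeAt_of_segment_subset ?_)
    rw [zero_add, segment_eq_image']
    rintro _ ⟨t, ht, rfl⟩
    refine ⟨?_, ?_⟩
    · simp [norm_smul, hθ, abs_le]
      constructor <;> linarith [ht.1, ht.2]
    · simp [inner_smul_right, hθ, ht.1]
  have hud : DifferentiableAt ℝ u 0 := (h.smooth 0 (by simp)).differentiableAt (by norm_num)
  have hpd : DifferentiableAt ℝ p 0 :=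
    (PK_smooth hζ (by simp) α).differentiableAt (by norm_num)
  have hSd : HasFDerivAt (fun x => u (S x))
      ((fderiv ℝ u 0).comp ((S : E ≃L[ℝ] E) : E →L[ℝ] E)) 0 := by
    refine HasFDerivAt.comp (g := u) (f := S) 0 ?_ (S : E ≃L[ℝ] E).hasFDerivAt
    simpa using hud.hasFDerivAt
  have hfin : HasFDerivAt g ((1 / 2 : ℝ) • fderiv ℝ u 0 + (-1 / 2 : ℝ) •
      ((fderiv ℝ u 0).comp ((S : E ≃L[ℝ] E) : E →L[ℝ] E)) + M • fderiv ℝ p 0) 0 :=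
    ((hud.hasFDerivAt.const_mul _).add (hSd.const_mul _)).add
      ((hpd.hasFDerivAt.const_mul _).add_const _)
  have hpf : fderiv ℝ p 0 θ = -2 * α := by
    rw [hp, PK_fderiv hζ (by simp)]
    simp [PK, hθ]
    ring
  rw [hfin.fderiv] at hneg
  have hSθ : S θ = -θ := Submodule.reflection_orthogonalComplement_singleton_eq_neg θ
  simp [hpf, hSθ] at hneg
  linarith

theorem core {u : E → ℝ} {M : ℝ} (hM : 0 < M) (h : Nice u M) (z : E) (hz : ‖z‖ < 1)
    (θ : E) (hθ : ‖θ‖ = 1) :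
    fderiv ℝ u z θ ≤ 2 * ((Module.finrank ℝ E : ℝ) - 1) * M / (1 - ‖z‖ ^ 2) := by
  by_cases hz0 : z = 0
  · subst hz0
    simpa using core_zero hM h θ hθ
  have hzp : 0 < ‖z‖ := norm_pos_iff.2 hz0
  have hN : 0 < 1 - ‖z‖ ^ 2 := by nlinarith
  set c : E := (‖z‖ ^ 2)⁻¹ • z with hc
  set ρ : ℝ := √((1 - ‖z‖ ^ 2) * (‖z‖ ^ 2)⁻¹) with hρ
  have hρ2 : ρ ^ 2 = (1 - ‖z‖ ^ 2) * (‖z‖ ^ 2)⁻¹ := Real.sq_sqrt (by positivity)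
  have hρ0 : ρ ≠ 0 := (Real.sqrt_pos.2 (by positivity)).ne'
  have hcn : ‖c‖ ^ 2 = (‖z‖ ^ 2)⁻¹ := by
    rw [hc, norm_smul, mul_pow, Real.norm_eq_abs, sq_abs]
    field_simp
  have hc2 : ‖c‖ ^ 2 = 1 + ρ ^ 2 := by
    rw [hcn, hρ2]; field_simp; ring
  have hc0 : (0 : E) ≠ c := by
    intro h0
    rw [← h0] at hcn
    have : 0 < (‖z‖ ^ 2)⁻¹ := by positivity
    rw [← hcn] at this
    simp at this
  have hR0 : EuclideanGeometry.inversion c ρ 0 = z := by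
    have : (ρ / ‖c‖) ^ 2 = 1 - ‖z‖ ^ 2 := by
      rw [div_pow, hcn, hρ2]; field_simp
    simp only [EuclideanGeometry.inversion, dist_eq_norm, zero_sub, norm_neg, this, vsub_eq_sub,
      vadd_eq_add]
    rw [hc]
    match_scalars
    field_simp
    ring
  have hv := h.inversion c ρ hρ0 hc2
  set A := (ℝ ∙ ((0:E) - c))ᗮ.reflection with hA
  have hθ' : ‖A.symm θ‖ = 1 := by simpa using hθ
  have h1 := core_zero hM hv (A.symm θ) hθ'
  have hud : HasFDerivAt u (fderiv ℝ u z) (EuclideanGeometry.inversion c ρ 0) := by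
    rw [hR0]
    exact ((h.smooth z (by simpa using hz)).differentiableAt (by norm_num)).hasFDerivAt
  have h2 := (hud.comp (0:E) (EuclideanGeometry.hasFDerivAt_inversion hc0)).fderiv
  have h3 : fderiv ℝ (fun x => u (EuclideanGeometry.inversion c ρ x)) 0 (A.symm θ) =
      (1 - ‖z‖ ^ 2) * fderiv ℝ u z θ := by
    change fderiv ℝ (u ∘ (EuclideanGeometry.inversion c ρ)) 0 (A.symm θ) = _
    rw [h2]
    have h4 : (ρ / dist 0 c) ^ 2 = 1 - ‖z‖ ^ 2 := by
      rw [dist_eq_norm, zero_sub, norm_neg, div_pow, hcn, hρ2]; field_simp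
    rw [h4]
    have h5 : A (A.symm θ) = θ := A.apply_symm_apply θ
    change fderiv ℝ u z ((1 - ‖z‖ ^ 2) • A (A.symm θ)) = _
    rw [h5, map_smul, smul_eq_mul]
  rw [h3] at h1
  rw [le_div_iff₀ hN]
  linarith

end HypCore
section Final
open Filter Topology

theorem finrank_Cn (n : ℕ) : (Module.finrank ℝ (Cn n) : ℝ) = 2 * n := by
  have := Module.finrank_eq_card_basis
    (Pi.orthonormalBasis (fun _ : Fin n => Complex.orthonormalBasisOneI)).toBasis
  rw [show Module.finrank ℝ (Cn n) = _ from this]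
  simp [mul_comm]

theorem Cn_decomp (n : ℕ) (θ : Cn n) :
    θ = ∑ k, ((θ k).re • (EuclideanSpace.single k (1:ℂ) : Cn n) +
      (θ k).im • (EuclideanSpace.single k Complex.I : Cn n)) := by
  ext j
  simp only [WithLp.ofLp_sum, WithLp.ofLp_add, WithLp.ofLp_smul, Finset.sum_apply, Pi.add_apply,
    Pi.smul_apply, PiLp.single_apply, Finset.sum_add_distrib]
  simp [Complex.re_add_im]

theorem laplaceH_eq (n : ℕ) {u : Cn n → ℝ} {z : Cn n} (hu : ContDiffAt ℝ 2 u z) :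
    laplaceH n u z = (1 - ‖z‖ ^ 2) * LL u z := by
  have hd : DifferentiableAt ℝ (fderiv ℝ u) z :=
    (hu.fderiv_right (m := 1) (by norm_num)).differentiableAt (by norm_num)
  have h1 : ∀ e : Cn n, fderiv ℝ (fun w => fderiv ℝ u w e) z e = fderiv ℝ (fderiv ℝ u) z e e := by
    intro e
    rw [fderiv_clm_apply hd (differentiableAt_const e)]
    simp
  have h2 : fderiv ℝ u z z = ∑ k, ((z k).re * fderiv ℝ u z (EuclideanSpace.single k 1) +
            (z k).im * fderiv ℝ u z (EuclideanSpace.single k Complex.I)) := by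
    conv_lhs => rw [Cn_decomp n z]
    simp only [map_sum, map_add, map_smul, smul_eq_mul]
    rw [← Cn_decomp n z]
  unfold laplaceH LL
  rw [lapl_eq (Pi.orthonormalBasis (fun _ : Fin n => Complex.orthonormalBasisOneI)), finrank_Cn, h2,
    Fintype.sum_sigma]
  simp only [h1, Fin.sum_univ_two, Pi.orthonormalBasis_apply, Complex.coe_orthonormalBasisOneI,
    Matrix.cons_val_zero, Matrix.cons_val_one]
  ring

theorem wd_eq (n : ℕ) (g : Cn n → ℂ) (z θ : Cn n) :
    ∑ k, (wdz n g z k * θ k + wdzbar n g z k * (starRingEnd ℂ) (θ k)) = fderiv ℝ g z θ := by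
  conv_rhs => rw [Cn_decomp n θ]
  simp only [map_sum, map_add, map_smul, Complex.real_smul]
  refine Finset.sum_congr rfl fun k _ => ?_
  unfold wdz wdzbar
  have h1 := Complex.re_add_im (θ k)
  have h2 : (starRingEnd ℂ) (θ k) = (θ k).re - (θ k).im * Complex.I := by
    apply Complex.ext <;> simp
  rw [h2]
  nth_rw 1 [← h1]
  linear_combination (-((fderiv ℝ g z) (EuclideanSpace.single k I)) * (θ k).im) * Complex.I_sq

end Final

/-- Let `f : Bⁿ → ℂⁿ` be continuous on the closed unit ball,
`h`-harmonic in each component, with `|f(z)| ≤ M` on `Bⁿ`. Then for every `z ∈ Bⁿ`,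
`Λ_f(z) ≤ 2(2n−1)M/(1−|z|)²`. -/
theorem schwarzPick_type_derivative (n : ℕ) (hn : 1 ≤ n) (M : ℝ) (hM : 0 < M)
    (f : Cn n → Cn n) (hcont : ContinuousOn f (closedBall 0 1))
    (hh : ∀ j : Fin n, IsHHarmonic n (fun w => f w j))
    (hbd : ∀ z ∈ ball (0 : Cn n) 1, ‖f z‖ ≤ M)
    (z : Cn n) (hz : z ∈ ball (0 : Cn n) 1) :
    LambdaF n f z ≤ 2 * (2 * (n : ℝ) - 1) * M / (1 - ‖z‖) ^ 2 := by
  have hz1 : ‖z‖ < 1 := by simpa using hz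
  have hz0 := norm_nonneg z
  have hn1 : (1 : ℝ) ≤ n := by exact_mod_cast hn
  have hfs : ∀ j, ∀ x ∈ ball (0 : Cn n) 1, ContDiffAt ℝ 2 (fun w => f w j) x := fun j x hx =>
    (hh j).1.contDiffAt (isOpen_ball.mem_nhds hx)
  have hbd' : ∀ x ∈ closedBall (0 : Cn n) 1, ‖f x‖ ≤ M := by
    intro x hx
    have hcl : closure (ball (0 : Cn n) 1) = closedBall 0 1 := closure_ball _ one_ne_zero
    rw [← hcl] at hx hcont
    exact le_on_closure hbd hcont.norm continuousOn_const hx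
  have hpos : 0 < 1 - ‖z‖ := by linarith
  have hB : 0 ≤ 2 * (2 * (n : ℝ) - 1) * M / (1 - ‖z‖) ^ 2 := by
    have : 0 ≤ 2 * (n : ℝ) - 1 := by linarith
    positivity
  unfold LambdaF
  refine Real.sSup_le ?_ hB
  rintro _ ⟨θ, hθ, rfl⟩
  have hθ1 : ‖θ‖ = 1 := by simpa using hθ
  simp only [wd_eq]
  set V : Cn n := WithLp.toLp 2 (fun j => fderiv ℝ (fun w => f w j) z θ) with hV
  have hVn : euclNorm n (fun j => fderiv ℝ (fun w => f w j) z θ) = ‖V‖ := by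
    rw [EuclideanSpace.norm_eq]
    simp only [euclNorm, Complex.normSq_eq_norm_sq, hV]
  rw [hVn]
  by_cases hV0 : V = 0
  · rw [hV0, norm_zero]; exact hB
  have hVp : 0 < ‖V‖ := norm_pos_iff.2 hV0
  set u : Cn n → ℝ := fun x => ∑ j, ((V j).re * (f x j).re + (V j).im * (f x j).im) with hu
  have hre : ∀ j, ∀ x ∈ ball (0 : Cn n) 1, ContDiffAt ℝ 2 (fun w => (f w j).re) x := fun j x hx =>
    Complex.reCLM.contDiff.contDiffAt.comp x (hfs j x hx)
  have him : ∀ j, ∀ x ∈ ball (0 : Cn n) 1, ContDiffAt ℝ 2 (fun w => (f w j).im) x := fun j x hx =>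
    Complex.imCLM.contDiff.contDiffAt.comp x (hfs j x hx)
  have hnice : Nice u (‖V‖ * M) := by
    refine ⟨?_, ?_, ?_, ?_⟩
    · have hj : ∀ j, ContinuousOn (fun x => f x j) (closedBall 0 1) := fun j =>
        (EuclideanSpace.proj (𝕜 := ℂ) j).continuous.comp_continuousOn hcont
      refine continuousOn_finsetSum _ fun j _ => ?_
      exact (continuousOn_const.mul (Complex.continuous_re.comp_continuousOn (hj j))).add
        (continuousOn_const.mul (Complex.continuous_im.comp_continuousOn (hj j)))
    · intro x hx
      exact ContDiffAt.sum fun j _ => (contDiffAt_const.mul (hre j x hx)).add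
        (contDiffAt_const.mul (him j x hx))
    · intro x hx
      have hx1 : ‖x‖ < 1 := by simpa using hx
      have hN : 1 - ‖x‖ ^ 2 ≠ 0 := by nlinarith [norm_nonneg x]
      rw [hu, LL_sum _ fun j _ => (contDiffAt_const.mul (hre j x hx)).add
        (contDiffAt_const.mul (him j x hx))]
      refine Finset.sum_eq_zero fun j _ => ?_
      rw [LL_add (contDiffAt_const.mul (hre j x hx)) (contDiffAt_const.mul (him j x hx)),
        LL_smul _ (hre j x hx), LL_smul _ (him j x hx)]
      have h1 := ((hh j).2 x hx).1
      have h2 := ((hh j).2 x hx).2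
      rw [laplaceH_eq n (hre j x hx)] at h1
      rw [laplaceH_eq n (him j x hx)] at h2
      rw [(mul_eq_zero.1 h1).resolve_left hN, (mul_eq_zero.1 h2).resolve_left hN]
      simp
    · intro x hx
      have e : u x = inner ℝ V (f x) := by
        simp only [hu, PiLp.inner_apply, Complex.inner]
        refine Finset.sum_congr rfl fun j _ => ?_
        simp; ring
      rw [e]
      exact (abs_real_inner_le_norm V (f x)).trans
        (mul_le_mul_of_nonneg_left (hbd' x hx) (norm_nonneg V))
  have hDu : fderiv ℝ u z θ = ‖V‖ ^ 2 := by
    have hd : ∀ j, HasFDerivAt (fun w => f w j) (fderiv ℝ (fun w => f w j) z) z := fun j =>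
      ((hfs j z hz).differentiableAt (by norm_num)).hasFDerivAt
    have h1 : HasFDerivAt u (∑ j, ((V j).re • (Complex.reCLM.comp (fderiv ℝ (fun w => f w j) z)) +
        (V j).im • (Complex.imCLM.comp (fderiv ℝ (fun w => f w j) z)))) z := by
      refine HasFDerivAt.fun_sum fun j _ => ?_
      exact ((Complex.reCLM.hasFDerivAt.comp z (hd j)).const_mul _).add
        ((Complex.imCLM.hasFDerivAt.comp z (hd j)).const_mul _)
    rw [h1.fderiv, EuclideanSpace.norm_sq_eq]
    simp only [sum_apply, add_apply, smul_apply, ContinuousLinearMap.comp_apply]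
    refine Finset.sum_congr rfl fun j _ => ?_
    have : fderiv ℝ (fun w => f w j) z θ = V j := rfl
    rw [this, ← Complex.normSq_eq_norm_sq, Complex.normSq_apply]
    rfl
  have hmain := core (mul_pos hVp hM) hnice z hz1 θ hθ1
  rw [hDu, finrank_Cn] at hmain
  have h1 : ‖V‖ ≤ 2 * (2 * (n : ℝ) - 1) * M / (1 - ‖z‖ ^ 2) := by
    have e : 2 * (2 * (n : ℝ) - 1) * (‖V‖ * M) / (1 - ‖z‖ ^ 2) =
      ‖V‖ * (2 * (2 * (n : ℝ) - 1) * M / (1 - ‖z‖ ^ 2)) := by ring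
    rw [e, sq] at hmain
    exact le_of_mul_le_mul_left hmain hVp
  refine h1.trans (div_le_div_of_nonneg_left ?_ (by positivity) (by nlinarith))
  have : 0 ≤ 2 * (n : ℝ) - 1 := by linarith
  positivity
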